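/- arXiv:2006.11350 — 2 statements merged into one kernel-verified Lean document; each statement's English description precedes it below -/
import Mathlib

section
/- Let (Ω, 𝓕, P) be a probability space, C : Ω → 𝒞 a protected attribute taking values in a countable set 𝒞, Y : Ω → {0,1} a binary label, and s̄ : Ω → [0,1) a randomized score. Let 0 = i₁ < i₂ < ⋯ < i_{K+1} = 1 and I_k = [i_k, i_{k+1}) for k = 1,…,K, and let ε₀, ε₁ ≥ 0. Assume: (a) for each k there is a function F_k : I_k → [0,1] such that for all c ∈ 𝒞, y ∈ {0,1}, and t ∈ I_k with P(s̄ ∈ I_k, C = c, Y = y) > 0, P(s̄ ≤ t | s̄ ∈ I_k, C = c, Y = y) = F_k(t); and (b) for every k ∈ {1,…,K+1}, every y ∈ {0,1}, and all c₁, c₂ ∈ 𝒞 with P(C = c₁, Y = y) > 0, P(C = c₂, Y = y) > 0, and P(s̄ < i_k | C = c₂, Y = y) > 0, one has exp(−ε_y) ≤ P(s̄ < i_k | C = c₁, Y = y) / P(s̄ < i_k | C = c₂, Y = y) ≤ exp(ε_y). Then s̄ satisfies (ε₀, ε₁)-differentially equalized odds in rankings: for all t ∈ [0,1), y ∈ {0,1},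 and c₁, c₂ as above with P(s̄ ≤ t | C = c₂, Y = y) > 0, exp(−ε_y) ≤ P(s̄ ≤ t | C = c₁, Y = y) / P(s̄ ≤ t | C = c₂, Y = y) ≤ exp(ε_y). -/
open MeasureTheory ProbabilityTheory

/-- A point between the first and the last value of a finite sequence lies in one of the half-open
intervals cut out by consecutive values. -/
theorem exists_mem_Ico_castSucc_succ {α : Type*} [LinearOrder α] {K : ℕ} {i : Fin (K + 1) → α}
    {t : α} (h0 : i 0 ≤ t) (hK : t < i (Fin.last K)) :
    ∃ k : Fin K, t ∈ Set.Ico (i k.castSucc) (i k.succ) := by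
  by_contra! h
  have hle : ∀ k, i k ≤ t := fun k => by
    induction k using Fin.induction with
    | zero => exact h0
    | succ k ih => exact not_lt.1 fun hlt => h k ⟨ih, hlt⟩
  exact (hle _).not_gt hK

/-- If, conditionally on `X ∈ [a, b)`, the event `X ≤ t` has probability `f`, then its probability
interpolates between those of `X < a` and `X < b` with weight `f`. -/
theorem measureReal_le_eq_interpolation {Ω : Type*} [MeasurableSpace Ω] {Q : Measure Ω}
    [IsFiniteMeasure Q] {X : Ω → ℝ} (hX : Measurable X) {a b t f : ℝ} (ht : t ∈ Set.Ico a b)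
    (hf : 0 < Q {ω | X ω ∈ Set.Ico a b} →
      (Q[{ω | X ω ≤ t} | {ω | X ω ∈ Set.Ico a b}]).toReal = f) :
    Q.real {ω | X ω ≤ t} = (1 - f) * Q.real {ω | X ω < a} + f * Q.real {ω | X ω < b} := by
  set S := {ω | X ω ∈ Set.Ico a b} with hS
  have hSm : MeasurableSet S := hX measurableSet_Ico
  have hb : Q.real {ω | X ω < b} = Q.real {ω | X ω < a} + Q.real S := by
    rw [← measureReal_union _ hSm]
    · congr 1
      ext ω
      have := ht.1.trans_lt ht.2
      simp only [hS, Set.mem_ofPred_eq, Set.mem_union, Set.mem_Ico]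
      grind
    · exact Set.disjoint_left.2 fun ω h h' => (h'.1.trans_lt h).false
  have hle : Q.real {ω | X ω ≤ t} =
      Q.real {ω | X ω < a} + Q.real (S ∩ {ω | X ω ≤ t}) := by
    have hSt : MeasurableSet (S ∩ {ω | X ω ≤ t}) := hSm.inter (hX measurableSet_Iic)
    rw [← measureReal_union _ hSt]
    · congr 1
      ext ω
      have := ht.1
      have := ht.2
      simp only [hS, Set.mem_ofPred_eq, Set.mem_union, Set.mem_inter_iff, Set.mem_Ico]
      grind
    · exact Set.disjoint_left.2 fun ω h h' => (h'.1.1.trans_lt h).false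
  have hinter : Q.real (S ∩ {ω | X ω ≤ t}) = f * Q.real S := by
    rcases eq_or_ne (Q S) 0 with h0 | h0
    · have h1 : Q.real S = 0 := by simp [measureReal_def, h0]
      rw [h1, mul_zero, measureReal_def, measure_mono_null Set.inter_subset_left h0,
        ENNReal.toReal_zero]
    · rw [← hf (pos_iff_ne_zero.2 h0), measureReal_def, measureReal_def, ← ENNReal.toReal_mul,
        cond_mul_eq_inter hSm]
  rw [hle, hinter, hb]
  ring

/-- Two-sided multiplicative bounds on ratios, in both directions, bound each value by the other
even where the ratio has denominator zero. -/
theorem mul_le_and_le_mul_of_ratio_bounds {x y l u : ℝ} (hl : 0 < l) (hx : 0 ≤ x) (hy : 0 ≤ y)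
    (hxy : 0 < y → l ≤ x / y ∧ x / y ≤ u) (hyx : 0 < x → l ≤ y / x) :
    l * y ≤ x ∧ x ≤ u * y := by
  rcases hy.eq_or_lt with rfl | hy
  · rcases hx.eq_or_lt with rfl | hx
    · simp
    · have := hyx hx
      rw [zero_div] at this
      exact absurd this hl.not_ge
  · exact ⟨(le_div_iff₀ hy).1 (hxy hy).1, (div_le_iff₀ hy).1 (hxy hy).2⟩

/-- relaxed analogue of Theorem 1, `(ε₀, ε₁)`-differential equalized
odds: if (a) the within-interval conditional distribution of the randomized score `s̄`
is a fixed distribution `F k` per interval, and (b) the cumulative probabilities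
`P(s̄ < i_k | C = c, Y = y)` at every partition boundary `i_k`, `k ∈ {1,…,K+1}`, satisfy
the multiplicative bounds `exp(−ε_y) ≤ ratio ≤ exp(ε_y)` across protected groups, then
the same multiplicative bounds hold for `P(s̄ ≤ t | C = c, Y = y)` at every threshold
`t ∈ [0,1)`. -/
theorem differential_equalized_odds_reranking
    {Ω 𝒞 : Type*} [MeasurableSpace Ω] [Countable 𝒞]
    (P : Measure Ω) [IsProbabilityMeasure P]
    (C : Ω → 𝒞) (Y : Ω → Bool) (sbar : Ω → ℝ)
    (hC : ∀ c, MeasurableSet {ω | C ω = c}) (hY : Measurable Y)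
    (hsbar : Measurable sbar)
    (hrange : ∀ ω, sbar ω ∈ Set.Ico (0 : ℝ) 1)
    (K : ℕ) (i : Fin (K + 1) → ℝ) (hi0 : i 0 = 0) (hiK : i (Fin.last K) = 1)
    (himono : StrictMono i)
    (I : Fin K → Set ℝ) (hI : ∀ k : Fin K, I k = Set.Ico (i k.castSucc) (i k.succ))
    (ε : Bool → ℝ) (hε : ∀ y, 0 ≤ ε y)
    (F : Fin K → ℝ → ℝ)
    (hF01 : ∀ (k : Fin K), ∀ t ∈ I k, F k t ∈ Set.Icc (0 : ℝ) 1)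
    (ha : ∀ (k : Fin K) (c : 𝒞) (y : Bool), ∀ t ∈ I k,
      0 < P ({ω | sbar ω ∈ I k} ∩ {ω | C ω = c} ∩ {ω | Y ω = y}) →
      (P[{ω | sbar ω ≤ t} |
          {ω | sbar ω ∈ I k} ∩ {ω | C ω = c} ∩ {ω | Y ω = y}]).toReal = F k t)
    (hb : ∀ (k : Fin (K + 1)) (y : Bool) (c₁ c₂ : 𝒞),
      0 < P ({ω | C ω = c₁} ∩ {ω | Y ω = y}) →
      0 < P ({ω | C ω = c₂} ∩ {ω | Y ω = y}) →
      0 < (P[{ω | sbar ω < i k} | {ω | C ω = c₂} ∩ {ω | Y ω = y}]).toReal →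
      Real.exp (-(ε y)) ≤
          (P[{ω | sbar ω < i k} | {ω | C ω = c₁} ∩ {ω | Y ω = y}]).toReal /
            (P[{ω | sbar ω < i k} | {ω | C ω = c₂} ∩ {ω | Y ω = y}]).toReal ∧
        (P[{ω | sbar ω < i k} | {ω | C ω = c₁} ∩ {ω | Y ω = y}]).toReal /
            (P[{ω | sbar ω < i k} | {ω | C ω = c₂} ∩ {ω | Y ω = y}]).toReal ≤
          Real.exp (ε y)) :
    ∀ t ∈ Set.Ico (0 : ℝ) 1, ∀ (y : Bool) (c₁ c₂ : 𝒞),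
      0 < P ({ω | C ω = c₁} ∩ {ω | Y ω = y}) →
      0 < P ({ω | C ω = c₂} ∩ {ω | Y ω = y}) →
      0 < (P[{ω | sbar ω ≤ t} | {ω | C ω = c₂} ∩ {ω | Y ω = y}]).toReal →
      Real.exp (-(ε y)) ≤
          (P[{ω | sbar ω ≤ t} | {ω | C ω = c₁} ∩ {ω | Y ω = y}]).toReal /
            (P[{ω | sbar ω ≤ t} | {ω | C ω = c₂} ∩ {ω | Y ω = y}]).toReal ∧
        (P[{ω | sbar ω ≤ t} | {ω | C ω = c₁} ∩ {ω | Y ω = y}]).toReal /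
            (P[{ω | sbar ω ≤ t} | {ω | C ω = c₂} ∩ {ω | Y ω = y}]).toReal ≤
          Real.exp (ε y) := by
  intro t ht y c₁ c₂ h₁ h₂ hpos
  obtain ⟨k, hk⟩ := exists_mem_Ico_castSucc_succ (hi0.trans_le ht.1) (ht.2.trans_eq hiK.symm)
  have htI : t ∈ I k := by rwa [hI]
  obtain ⟨hF0, hF1⟩ := hF01 k t htI
  have key : ∀ c, (P[{ω | sbar ω ≤ t} | {ω | C ω = c} ∩ {ω | Y ω = y}]).toReal =
      (1 - F k t) *
          (P[{ω | sbar ω < i k.castSucc} | {ω | C ω = c} ∩ {ω | Y ω = y}]).toReal +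
        F k t * (P[{ω | sbar ω < i k.succ} | {ω | C ω = c} ∩ {ω | Y ω = y}]).toReal := by
    intro c
    have hN : MeasurableSet ({ω | C ω = c} ∩ {ω | Y ω = y}) :=
      (hC c).inter (hY (measurableSet_singleton y))
    refine measureReal_le_eq_interpolation hsbar hk fun hS => ?_
    have hSm : MeasurableSet {ω | sbar ω ∈ Set.Ico (i k.castSucc) (i k.succ)} :=
      hsbar measurableSet_Ico
    have hcomm : {ω | C ω = c} ∩ {ω | Y ω = y} ∩
        {ω | sbar ω ∈ Set.Ico (i k.castSucc) (i k.succ)} =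
        {ω | sbar ω ∈ I k} ∩ {ω | C ω = c} ∩ {ω | Y ω = y} := by
      rw [hI, Set.inter_comm, Set.inter_assoc]
    rw [cond_cond_eq_cond_inter hN hSm, hcomm]
    refine ha k c y t htI ?_
    rw [← hcomm]
    exact inter_pos_of_cond_ne_zero hN hS.ne'
  have bound : ∀ j, Real.exp (-(ε y)) *
        (P[{ω | sbar ω < i j} | {ω | C ω = c₂} ∩ {ω | Y ω = y}]).toReal ≤
          (P[{ω | sbar ω < i j} | {ω | C ω = c₁} ∩ {ω | Y ω = y}]).toReal ∧
      (P[{ω | sbar ω < i j} | {ω | C ω = c₁} ∩ {ω | Y ω = y}]).toReal ≤ Real.exp (ε y) *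
        (P[{ω | sbar ω < i j} | {ω | C ω = c₂} ∩ {ω | Y ω = y}]).toReal := fun j =>
    mul_le_and_le_mul_of_ratio_bounds (Real.exp_pos _) ENNReal.toReal_nonneg
      ENNReal.toReal_nonneg (hb j y c₁ c₂ h₁ h₂) fun h => (hb j y c₂ c₁ h₂ h₁ h).1
  obtain ⟨hla, hua⟩ := bound k.castSucc
  obtain ⟨hlb, hub⟩ := bound k.succ
  rw [le_div_iff₀ hpos, div_le_iff₀ hpos, key c₁, key c₂]
  have hF1' := sub_nonneg.2 hF1
  constructor
  · linarith [mul_le_mul_of_nonneg_left hla hF1', mul_le_mul_of_nonneg_left hlb hF0]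
  · linarith [mul_le_mul_of_nonneg_left hua hF1', mul_le_mul_of_nonneg_left hub hF0]
end

section
/- Consider the position-bias model: on a probability space (Ω, 𝓕, P), let S : Ω → ℝ be a score, C : Ω → 𝒞 a protected attribute taking values in a countable set 𝒞, γ : Ω → {1,…,K} a position, and Y₁,…,Y_K : Ω → {0,1} counterfactual labels; write Y_γ(ω) = Y_{γ(ω)}(ω) and w_j = P(Y_j = 1 | Y₁ = 1). Assume homogeneity: for every j, conditionally on {Y₁ = 1}, Y_j is independent of (S, γ, C) with P(Y_j = 1 | Y₁ = 1, S, γ, C) = w_j almost surely; assume preservation of hierarchy: Y_j ≤ Y₁ almost surely for every j; assume w_j > 0 for all j; and assume P(γ = j, Y_γ = 1, C = c) > 0 for every j and the relevant c. Define, for each c and t ∈ ℝ, the weighted conditional CDF F*_{c,1}(t) = Σ_{j=1}^{K} P(S ≤ t | γ = j, Y_j = 1, C = c) · [P(γ = j | Y_γ = 1, C = c)/w_j] / [Σ_{r=1}^{K} P(γ = r | Y_γ = 1, C = c)/w_r]. Then for every t ∈ ℝ and every c with P(Y₁ = 1, C = c) > 0: F*_{c,1}(t) = P(S ≤ t | Y₁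 = 1, C = c). -/
open MeasureTheory ProbabilityTheory

theorem sum_measureReal_inter_fiber {Ω ι : Type*} [MeasurableSpace Ω] [Fintype ι]
    [MeasurableSpace ι] [MeasurableSingletonClass ι] (μ : Measure Ω) [IsFiniteMeasure μ]
    {g : Ω → ι} (hg : Measurable g) {s : Set Ω} (hs : MeasurableSet s) :
    ∑ i, μ.real (s ∩ {ω | g ω = i}) = μ.real s := by
  have hm : ∀ i, MeasurableSet (s ∩ {ω | g ω = i}) := fun i =>
    hs.inter (hg (measurableSet_singleton i))
  rw [← measureReal_iUnion_fintype _ hm]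
  · congr 1
    ext ω
    simp
  · intro i j hij
    refine Set.disjoint_left.2 ?_
    rintro ω ⟨-, hi⟩ ⟨-, hj⟩
    exact hij (hi.symm.trans hj)

theorem toReal_cond_apply {Ω : Type*} [MeasurableSpace Ω] (μ : Measure Ω)
    {s : Set Ω} (hs : MeasurableSet s) (t : Set Ω) :
    (μ[t | s]).toReal = μ.real (s ∩ t) / μ.real s := by
  rw [cond_apply hs, ENNReal.toReal_mul, ENNReal.toReal_inv, div_eq_inv_mul]
  rfl

/-- central computation in the proof of Theorem 2 of the paper: in the
position-bias model with homogeneity, preservation of hierarchy and positive position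
biases `w j`, the inverse-propensity-weighted conditional CDF
`F*_{c,1}(t) = ∑ j P(S ≤ t | γ = j, Y_j = 1, C = c) ·
  [P(γ = j | Y_γ = 1, C = c)/w_j] / [∑ r P(γ = r | Y_γ = 1, C = c)/w_r]`
equals the conditional CDF of the score given the counterfactual positive response at
position 1: `F*_{c,1}(t) = P(S ≤ t | Y₁ = 1, C = c)`.
Positions are indexed by `Fin (K + 1)`, with `0` denoting position 1 (the top). -/
theorem weighted_cdf_equals_counterfactual_cdf
    {Ω 𝒞 : Type*} [MeasurableSpace Ω] [Countable 𝒞]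
    (P : Measure Ω) [IsProbabilityMeasure P]
    (K : ℕ) (S : Ω → ℝ) (C : Ω → 𝒞) (γ : Ω → Fin (K + 1))
    (Y : Fin (K + 1) → Ω → Bool) (Yobs : Ω → Bool)
    (hYobs : ∀ ω, Yobs ω = Y (γ ω) ω)
    (hS : Measurable S) (hC : ∀ c, MeasurableSet {ω | C ω = c})
    (hγ : Measurable γ) (hYm : ∀ j, Measurable (Y j))
    (w : Fin (K + 1) → ℝ)
    (hw : ∀ j, w j = (P[{ω | Y j ω = true} | {ω | Y 0 ω = true}]).toReal)
    (hwpos : ∀ j, 0 < w j)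
    (hHom : ∀ (j j' : Fin (K + 1)) (c : 𝒞) (B : Set ℝ), MeasurableSet B →
      (P ({ω | Y j ω = true} ∩
          ({ω | S ω ∈ B} ∩ {ω | γ ω = j'} ∩ {ω | C ω = c} ∩
            {ω | Y 0 ω = true}))).toReal
        = w j * (P ({ω | S ω ∈ B} ∩ {ω | γ ω = j'} ∩ {ω | C ω = c} ∩
            {ω | Y 0 ω = true})).toReal)
    (hHier : ∀ j, ∀ᵐ ω ∂P, Y j ω = true → Y 0 ω = true) :
    ∀ (t : ℝ) (c : 𝒞),
      (∀ j, 0 < P ({ω | γ ω = j} ∩ {ω | Y j ω = true} ∩ {ω | C ω = c})) →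
      0 < P ({ω | Y 0 ω = true} ∩ {ω | C ω = c}) →
      (∑ j, (P[{ω | S ω ≤ t} |
            {ω | γ ω = j} ∩ {ω | Y j ω = true} ∩ {ω | C ω = c}]).toReal *
          ((P[{ω | γ ω = j} | {ω | Yobs ω = true} ∩ {ω | C ω = c}]).toReal / w j)) /
        (∑ r, (P[{ω | γ ω = r} | {ω | Yobs ω = true} ∩ {ω | C ω = c}]).toReal / w r)
      = (P[{ω | S ω ≤ t} | {ω | Y 0 ω = true} ∩ {ω | C ω = c}]).toReal := by
  intro t c hpos _
  have hγm : ∀ j, MeasurableSet {ω | γ ω = j} := fun j => hγ (measurableSet_singleton j)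
  have hYs : ∀ j, MeasurableSet {ω | Y j ω = true} := fun j =>
    hYm j (measurableSet_singleton true)
  have hSt : MeasurableSet {ω | S ω ≤ t} := hS measurableSet_Iic
  have hYobs_eq : {ω | Yobs ω = true} = ⋃ j, {ω | γ ω = j} ∩ {ω | Y j ω = true} := by
    ext ω
    simp [hYobs]
  have hYobs_meas : MeasurableSet {ω | Yobs ω = true} := by
    rw [hYobs_eq]
    exact MeasurableSet.iUnion fun j => (hγm j).inter (hYs j)
  set top := {ω | Y 0 ω = true} ∩ {ω | C ω = c} with htop
  set obs := {ω | Yobs ω = true} ∩ {ω | C ω = c} with hobs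
  set cell : Fin (K + 1) → Set Ω :=
    fun j => {ω | γ ω = j} ∩ {ω | Y j ω = true} ∩ {ω | C ω = c} with hcell
  have htop_meas : MeasurableSet top := (hYs 0).inter (hC c)
  have hobs_meas : MeasurableSet obs := hYobs_meas.inter (hC c)
  have hcell_meas : ∀ j, MeasurableSet (cell j) := fun j => ((hγm j).inter (hYs j)).inter (hC c)
  have hobs_cell : ∀ j, obs ∩ {ω | γ ω = j} = cell j := by
    intro j
    ext ω
    simp only [hobs, hcell, Set.mem_inter_iff, Set.mem_ofPred_eq, hYobs]
    constructor
    · rintro ⟨⟨hy, hc⟩, rfl⟩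
      exact ⟨⟨rfl, hy⟩, hc⟩
    · rintro ⟨⟨rfl, hy⟩, hc⟩
      exact ⟨⟨hy, hc⟩, rfl⟩
  have hscale : ∀ j (B : Set ℝ), MeasurableSet B →
      P.real (cell j ∩ {ω | S ω ∈ B}) =
        w j * P.real (top ∩ {ω | S ω ∈ B} ∩ {ω | γ ω = j}) := by
    intro j B hB
    have htop_eq : top ∩ {ω | S ω ∈ B} ∩ {ω | γ ω = j} =
        {ω | S ω ∈ B} ∩ {ω | γ ω = j} ∩ {ω | C ω = c} ∩ {ω | Y 0 ω = true} := by
      ext ω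
      simp only [htop, Set.mem_inter_iff]
      tauto
    rw [htop_eq, measureReal_def, measureReal_def, ← hHom j j c B hB]
    congr 1
    apply measure_congr
    filter_upwards [hHier j] with ω hω
    apply propext
    change ω ∈ cell j ∩ {ω | S ω ∈ B} ↔ ω ∈ {ω | Y j ω = true} ∩
      ({ω | S ω ∈ B} ∩ {ω | γ ω = j} ∩ {ω | C ω = c} ∩ {ω | Y 0 ω = true})
    simp only [hcell, Set.mem_inter_iff, Set.mem_ofPred_eq]
    tauto
  have hscale_univ : ∀ j, P.real (cell j) = w j * P.real (top ∩ {ω | γ ω = j}) := by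
    intro j
    simpa using hscale j Set.univ MeasurableSet.univ
  have hcell_pos : ∀ j, 0 < P.real (cell j) := fun j =>
    ENNReal.toReal_pos (hpos j).ne' (measure_ne_top _ _)
  have hobs_pos : 0 < P.real obs :=
    (hcell_pos 0).trans_le <| measureReal_mono <| by
      rw [← hobs_cell 0]
      exact Set.inter_subset_left
  have hweight : ∀ j, (P[{ω | γ ω = j} | obs]).toReal / w j =
      P.real (top ∩ {ω | γ ω = j}) / P.real obs := by
    intro j
    rw [toReal_cond_apply P hobs_meas, hobs_cell, hscale_univ]
    have := (hwpos j).ne'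
    field_simp
  have hterm : ∀ j, (P[{ω | S ω ≤ t} | cell j]).toReal *
      ((P[{ω | γ ω = j} | obs]).toReal / w j) =
        P.real (top ∩ {ω | S ω ≤ t} ∩ {ω | γ ω = j}) / P.real obs := by
    intro j
    have hnum : P.real (cell j ∩ {ω | S ω ≤ t}) =
        w j * P.real (top ∩ {ω | S ω ≤ t} ∩ {ω | γ ω = j}) :=
      hscale j (Set.Iic t) measurableSet_Iic
    have hw0 := (hwpos j).ne'
    have htop0 : P.real (top ∩ {ω | γ ω = j}) ≠ 0 :=
      right_ne_zero_of_mul (hscale_univ j ▸ (hcell_pos j).ne')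
    rw [hweight, toReal_cond_apply P (hcell_meas j), hnum, hscale_univ]
    field_simp
  change (∑ j, (P[{ω | S ω ≤ t} | cell j]).toReal * _) / _ = _
  rw [Finset.sum_congr rfl fun j _ => hterm j, Finset.sum_congr rfl fun j _ => hweight j,
    ← Finset.sum_div, ← Finset.sum_div, sum_measureReal_inter_fiber P hγ (htop_meas.inter hSt),
    sum_measureReal_inter_fiber P hγ htop_meas, toReal_cond_apply P htop_meas,
    div_div_div_cancel_right₀ hobs_pos.ne']
end
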